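/- arXiv:1509.05306 — 3 statements merged into one kernel-verified Lean document; each statement's English description precedes it below -/
import Mathlib

section
/- Assume the field hypotheses (with arbitrary weight matrices replaced as follows). Let w : Ω → [0, ∞) be an integrable function. Then (∫_Ω w(t) A_t dμ(t)) ⊗_s (∫_Ω w(t) A_t⁻¹ dμ(t)) ≤ ((a² + b²)/(2ab)) · (∫_Ω w(t) dμ(t))² · I, where I is the k²×k² identity matrix. -/
open Matrix MeasureTheory
open scoped Kronecker ComplexOrder

attribute [local instance] Matrix.frobeniusNormedAddCommGroup Matrix.frobeniusNormedSpace

/-- Symmetrized Kronecker tensor product: `X ⊗ₛ Y = (1/2)(X ⊗ Y + Y ⊗ X)`. -/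
noncomputable def symKron {k : ℕ} (X Y : Matrix (Fin k) (Fin k) ℂ) :
    Matrix (Fin k × Fin k) (Fin k × Fin k) ℂ :=
  ((1 : ℂ) / 2) • (X ⊗ₖ Y + Y ⊗ₖ X)

section
open scoped MatrixOrder
lemma aux_mul_comm {k : ℕ} {P Q : Matrix (Fin k) (Fin k) ℂ} (hP : P.PosSemidef)
    (hQ : Q.PosSemidef) (h : Commute P Q) : (P * Q).PosSemidef := by
  rw [← Matrix.nonneg_iff_posSemidef] at *
  exact Commute.mul_nonneg hP hQ h

lemma aux_fact {k : ℕ} {P : Matrix (Fin k) (Fin k) ℂ} (hP : P.PosSemidef) :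
    ∃ B : Matrix (Fin k) (Fin k) ℂ, P = Bᴴ * B := by
  rw [← Matrix.nonneg_iff_posSemidef] at *
  exact CStarAlgebra.nonneg_iff_eq_star_mul_self.1 hP
end

lemma aux_norm {k : ℕ} {P : Matrix (Fin k) (Fin k) ℂ} (hP : P.PosSemidef) :
    ‖P‖ ≤ P.trace.re := by
  obtain ⟨B, rfl⟩ := aux_fact hP
  refine (Matrix.frobenius_norm_mul _ _).trans ?_
  rw [Matrix.frobenius_norm_conjTranspose, ← sq, Matrix.frobenius_norm_def, ← Real.sqrt_eq_rpow,
    Real.sq_sqrt (by positivity), Finset.sum_comm]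
  simp only [Matrix.trace, Matrix.diag, Matrix.mul_apply, Complex.re_sum, Matrix.conjTranspose_apply]
  refine le_of_eq (Finset.sum_congr rfl fun i _ => Finset.sum_congr rfl fun j _ => ?_)
  simp [Complex.sq_norm, Complex.normSq_apply]

lemma aux_bound {k : ℕ} {P : Matrix (Fin k) (Fin k) ℂ} {c : ℝ} (hP : P.PosSemidef)
    (h : (c • 1 - P).PosSemidef) : ‖P‖ ≤ c * k := by
  refine (aux_norm hP).trans ?_
  have := (Complex.le_def.1 h.trace_nonneg).1
  simp [Matrix.trace_sub, Matrix.trace_smul] at this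
  linarith

lemma aux_smul {n : Type*} {P : Matrix n n ℂ} {c : ℝ} (hc : 0 ≤ c)
    (hP : P.PosSemidef) : (c • P).PosSemidef := hP.smul hc

lemma aux_inv {k : ℕ} {A : Matrix (Fin k) (Fin k) ℂ} {a b : ℝ} (ha : 0 < a)
    (hAa : (A - a • 1).PosSemidef)
    (hAb : ((b • 1 : Matrix (Fin k) (Fin k) ℂ) - A).PosSemidef) :
    A.PosSemidef ∧ (A⁻¹).PosSemidef ∧ (a⁻¹ • 1 - A⁻¹).PosSemidef ∧
      ((a + b) • 1 - A - (a * b) • A⁻¹).PosSemidef := by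
  have hpd : A.PosDef := by
    have : A = (A - a • 1) + a • 1 := by abel
    rw [this]
    exact Matrix.PosDef.posSemidef_add hAa (Matrix.PosDef.one.smul ha)
  have hu : IsUnit A.det := (Matrix.isUnit_iff_isUnit_det _).1 hpd.isUnit
  have h1 : A * A⁻¹ = 1 := Matrix.mul_nonsing_inv _ hu
  have h2 : A⁻¹ * A = 1 := Matrix.nonsing_inv_mul _ hu
  have hi := hpd.posSemidef.inv
  have c1 : Commute (A - a • 1) A⁻¹ := by
    simp [Commute, SemiconjBy, sub_mul, mul_sub, h1, h2]
  have e1 : (A - a • 1) * A⁻¹ = 1 - a • A⁻¹ := by simp [sub_mul, h1]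
  have p1 := aux_mul_comm hAa hi c1
  rw [e1] at p1
  refine ⟨hpd.posSemidef, hi, ?_, ?_⟩
  · have := aux_smul (inv_nonneg.2 ha.le) p1
    rwa [smul_sub, smul_smul, inv_mul_cancel₀ ha.ne', one_smul] at this
  · have c2 : Commute (b • 1 - A) (1 - a • A⁻¹) := by
      simp [Commute, SemiconjBy, sub_mul, mul_sub, h1, h2, smul_sub, smul_smul, mul_comm a b]
      abel
    have p2 := aux_mul_comm hAb p1 c2
    have e2 : (b • 1 - A) * (1 - a • A⁻¹) = (a + b) • 1 - A - (a * b) • A⁻¹ := by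
      simp [sub_mul, mul_sub, h1, smul_sub, smul_smul, add_smul]
      abel
    rwa [e2] at p2

lemma aux_meas {k : ℕ} {Ω : Type*} [MeasurableSpace Ω] (μ : Measure Ω)
    (A : Ω → Matrix (Fin k) (Fin k) ℂ) (hA : AEStronglyMeasurable A μ) :
    AEStronglyMeasurable (fun t => (A t)⁻¹) μ := by
  simp only [Matrix.inv_def, Ring.inverse_eq_inv']
  have hd : AEStronglyMeasurable (fun t => (A t).det) μ :=
    (Continuous.matrix_det continuous_id).comp_aestronglyMeasurable hA
  have hj : AEStronglyMeasurable (fun t => (A t).adjugate) μ :=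
    (Continuous.matrix_adjugate continuous_id).comp_aestronglyMeasurable hA
  exact (hd.aemeasurable.inv.aestronglyMeasurable).smul hj

lemma aux_alg {k : ℕ} (X Y : Matrix (Fin k) (Fin k) ℂ) (a b m : ℝ) (ha : 0 < a) (hb : 0 < b) :
    (((a ^ 2 + b ^ 2) / (2 * a * b)) * m ^ 2) •
        (1 : Matrix (Fin k × Fin k) (Fin k × Fin k) ℂ) - symKron X Y =
    (2 * a * b)⁻¹ • (((b * m) • 1 - X) ⊗ₖ ((b * m) • 1 - X) + (X - (a * m) • 1) ⊗ₖ (X - (a * m) • 1)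
      + X ⊗ₖ (((a + b) * m) • 1 - X - (a * b) • Y) + (((a + b) * m) • 1 - X - (a * b) • Y) ⊗ₖ X) := by
  have ha' : (a : ℂ) ≠ 0 := by exact_mod_cast ha.ne'
  have hb' : (b : ℂ) ≠ 0 := by exact_mod_cast hb.ne'
  rw [← Matrix.one_kronecker_one]
  ext ⟨i, j⟩ ⟨i', j'⟩
  simp only [symKron, Matrix.sub_apply, Matrix.add_apply, Matrix.smul_apply,
    Matrix.kroneckerMap_apply, Complex.real_smul, smul_eq_mul]
  push_cast
  field_simp
  ring

/-- The topology underlying the Frobenius norm, given priority over the product topology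
(they agree definitionally, but not at instance transparency). -/
noncomputable abbrev frobTop (k : ℕ) : TopologicalSpace (Matrix (Fin k) (Fin k) ℂ) :=
  (Matrix.frobeniusNormedAddCommGroup : NormedAddCommGroup
    (Matrix (Fin k) (Fin k) ℂ)).toMetricSpace.toPseudoMetricSpace.toUniformSpace.toTopologicalSpace

section
attribute [local instance] frobTop

lemma aux_int {k : ℕ} {Ω : Type*} [MeasurableSpace Ω] (μ : Measure Ω)
    (F : Ω → Matrix (Fin k) (Fin k) ℂ) (hF : Integrable F μ) (h : ∀ t, (F t).PosSemidef) :
    (∫ t, F t ∂μ).PosSemidef := by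
  refine Matrix.PosSemidef.of_dotProduct_mulVec_nonneg ?_ fun x => ?_
  · let L : Matrix (Fin k) (Fin k) ℂ →ₗ[ℝ] Matrix (Fin k) (Fin k) ℂ :=
      { toFun := fun M => Mᴴ
        map_add' := fun _ _ => Matrix.conjTranspose_add _ _
        map_smul' := fun c M => by simp [Matrix.conjTranspose_smul] }
    have := (LinearMap.toContinuousLinearMap L).integral_comp_comm hF
    change _ᴴ = _
    change _ = (∫ t, F t ∂μ)ᴴ at this
    rw [← this]
    exact integral_congr_ae (.of_forall fun t => (h t).1)
  · let L : Matrix (Fin k) (Fin k) ℂ →ₗ[ℝ] ℂ :=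
      { toFun := fun M => star x ⬝ᵥ (M *ᵥ x)
        map_add' := fun _ _ => by simp [Matrix.add_mulVec]
        map_smul' := fun c M => by simp [Matrix.smul_mulVec] }
    have := (LinearMap.toContinuousLinearMap L).integral_comp_comm hF
    change _ = star x ⬝ᵥ ((∫ t, F t ∂μ) *ᵥ x) at this
    rw [← this]
    exact integral_nonneg fun t => (h t).dotProduct_mulVec_nonneg x

lemma aux_integrable {k : ℕ} {Ω : Type*} [MeasurableSpace Ω] (μ : Measure Ω)
    (A : Ω → Matrix (Fin k) (Fin k) ℂ) (hA : AEStronglyMeasurable A μ) (C : ℝ)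
    (hC : ∀ t, ‖A t‖ ≤ C) (w : Ω → ℝ) (hw : ∀ t, 0 ≤ w t) (hwint : Integrable w μ) :
    Integrable (fun t => w t • A t) μ := by
  refine Integrable.mono' (hwint.mul_const C) (hwint.1.smul hA) (.of_forall fun t => ?_)
  rw [norm_smul, Real.norm_of_nonneg (hw t)]
  exact mul_le_mul_of_nonneg_left (hC t) (hw t)

lemma aux_core {k : ℕ} {Ω : Type*} [MeasurableSpace Ω]
    (μ : Measure Ω) [IsFiniteMeasure μ] (a b : ℝ) (ha : 0 < a) (hab : a ≤ b)
    (A : Ω → Matrix (Fin k) (Fin k) ℂ) (hAmeas : AEStronglyMeasurable A μ)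
    (hImeas : AEStronglyMeasurable (fun t => (A t)⁻¹) μ)
    (hAherm : ∀ t, (A t).IsHermitian)
    (hAa : ∀ t, (A t - a • 1).PosSemidef)
    (hAb : ∀ t, ((b • 1 : Matrix (Fin k) (Fin k) ℂ) - A t).PosSemidef)
    (w : Ω → ℝ) (hw : ∀ t, 0 ≤ w t) (hwint : Integrable w μ) :
    ((((a ^ 2 + b ^ 2) / (2 * a * b)) * (∫ t, w t ∂μ) ^ 2) •
        (1 : Matrix (Fin k × Fin k) (Fin k × Fin k) ℂ)
      - symKron (∫ t, w t • A t ∂μ) (∫ t, w t • (A t)⁻¹ ∂μ)).PosSemidef := by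
  have hb : 0 < b := ha.trans_le hab
  have H := fun t => aux_inv ha (hAa t) (hAb t)
  have iA := aux_integrable μ A hAmeas _ (fun t => aux_bound (H t).1 (hAb t)) w hw hwint
  have iI := aux_integrable μ _ hImeas _
    (fun t => aux_bound (H t).2.1 (H t).2.2.1) w hw hwint
  have i1 : ∀ c : ℝ, Integrable (fun t => (c * w t) • (1 : Matrix (Fin k) (Fin k) ℂ)) μ :=
    fun c => (hwint.const_mul c).smul_const _
  have v1 : ∀ c : ℝ, ∫ t, (c * w t) • (1 : Matrix (Fin k) (Fin k) ℂ) ∂μ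
      = (c * ∫ t, w t ∂μ) • 1 := fun c => by
    rw [integral_smul_const, integral_const_mul]
  have hX : (∫ t, w t • A t ∂μ).PosSemidef :=
    aux_int μ _ iA fun t => aux_smul (hw t) (H t).1
  have hP : ((∫ t, w t • A t ∂μ) - (a * ∫ t, w t ∂μ) • 1).PosSemidef := by
    rw [← v1, ← integral_sub iA (i1 a)]
    refine aux_int μ _ (iA.sub (i1 a)) fun t => ?_
    have := aux_smul (hw t) (hAa t)
    rwa [smul_sub, smul_smul, mul_comm] at this
  have hQ : ((b * ∫ t, w t ∂μ) • 1 - (∫ t, w t • A t ∂μ)).PosSemidef := by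
    rw [← v1, ← integral_sub (i1 b) iA]
    refine aux_int μ _ ((i1 b).sub iA) fun t => ?_
    have := aux_smul (hw t) (hAb t)
    rwa [smul_sub, smul_smul, mul_comm] at this
  have hZ : (((a + b) * ∫ t, w t ∂μ) • 1 - (∫ t, w t • A t ∂μ)
      - (a * b) • ∫ t, w t • (A t)⁻¹ ∂μ).PosSemidef := by
    have iI' : Integrable (fun t => (a * b) • w t • (A t)⁻¹) μ := iI.smul (a * b)
    have i2 : Integrable (fun t => ((a + b) * w t) • (1 : Matrix (Fin k) (Fin k) ℂ) - w t • A t) μ :=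
      (i1 (a + b)).sub iA
    rw [← v1, ← integral_sub (i1 (a + b)) iA, ← integral_smul, ← integral_sub i2 iI']
    refine aux_int μ _ (i2.sub iI') fun t => ?_
    have := aux_smul (hw t) (H t).2.2.2
    rwa [smul_sub, smul_sub, smul_smul, mul_comm, smul_comm] at this
  rw [aux_alg _ _ a b _ ha hb]
  exact aux_smul (by positivity) ((((hQ.kronecker hQ).add (hP.kronecker hP)).add
    (hX.kronecker hZ)).add (hZ.kronecker hX))
end

/-- Corollary 3.4: Kantorovich type integral inequality with scalar weights. -/
theorem kantorovich_integral_tensor_scalar_weight {k : ℕ} {Ω : Type*} [MeasurableSpace Ω]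
    (μ : Measure Ω) [IsFiniteMeasure μ] (a b : ℝ) (ha : 0 < a) (hab : a ≤ b)
    (A : Ω → Matrix (Fin k) (Fin k) ℂ) (hAmeas : AEStronglyMeasurable A μ)
    (hAherm : ∀ t, (A t).IsHermitian)
    (hAa : ∀ t, (A t - a • 1).PosSemidef)
    (hAb : ∀ t, ((b • 1 : Matrix (Fin k) (Fin k) ℂ) - A t).PosSemidef)
    (w : Ω → ℝ) (hw : ∀ t, 0 ≤ w t) (hwint : Integrable w μ) :
    ((((a ^ 2 + b ^ 2) / (2 * a * b)) * (∫ t, w t ∂μ) ^ 2) •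
        (1 : Matrix (Fin k × Fin k) (Fin k × Fin k) ℂ)
      - symKron (∫ t, w t • A t ∂μ) (∫ t, w t • (A t)⁻¹ ∂μ)).PosSemidef := by
  exact aux_core μ a b ha hab A hAmeas (aux_meas μ A hAmeas) hAherm hAa hAb w hw hwint
end

section
/- Let f : [0, ∞) → [0, ∞) be a continuous operator monotone and super-multiplicative function. Then for all positive definite k×k complex matrices A, B, C, D, one has (A σ_f C) ⊗_s (B σ_f D) ≤ (A ⊗_s B) σ_f (C ⊗_s D). -/
open Matrix MeasureTheory
open scoped Kronecker ComplexOrder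

attribute [local instance] Matrix.frobeniusNormedAddCommGroup Matrix.frobeniusNormedSpace

/-- The operator connection with representing function `f`:
`X σ_f Y = X^{1/2} f(X^{-1/2} Y X^{-1/2}) X^{1/2}`, where square roots and `f` are taken
via the continuous functional calculus for Hermitian matrices. -/
noncomputable def opConn {m : Type*} [Fintype m] [DecidableEq m] (f : ℝ → ℝ)
    (X Y : Matrix m m ℂ) : Matrix m m ℂ :=
  cfc Real.sqrt X * cfc f ((cfc Real.sqrt X)⁻¹ * Y * (cfc Real.sqrt X)⁻¹) * cfc Real.sqrt X


open Polynomial in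
lemma aux_poly (f : ℝ → ℝ) {n m : Type*} [Fintype n] [DecidableEq n] [Fintype m] [DecidableEq m]
    (Z : Matrix n n ℂ) (M : Matrix m m ℂ) (hZ : Z.IsHermitian) (hM : M.IsHermitian) :
    ∃ p : Polynomial ℝ, cfc f Z = Polynomial.aeval Z p ∧ cfc f M = Polynomial.aeval M p := by
  classical
  have h1 : (spectrum ℝ Z).Finite := Matrix.finite_real_spectrum
  have h2 : (spectrum ℝ M).Finite := Matrix.finite_real_spectrum
  let s : Finset ℝ := h1.toFinset ∪ h2.toFinset
  let p : Polynomial ℝ := Lagrange.interpolate s id f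
  have hp : ∀ x ∈ s, p.eval x = f x := fun x hx =>
    Lagrange.eval_interpolate_at_node (v := id) f (Set.injOn_id _) hx
  have hZ' : IsSelfAdjoint Z := hZ
  have hM' : IsSelfAdjoint M := hM
  refine ⟨p, ?_, ?_⟩
  · rw [← cfc_polynomial p Z hZ']
    refine cfc_congr fun x hx => (hp x ?_).symm
    simp [s, hx]
  · rw [← cfc_polynomial p M hM']
    refine cfc_congr fun x hx => (hp x ?_).symm
    simp [s, hx]

lemma aux_aeval_intertwine {n m : Type*} [Fintype n] [DecidableEq n] [Fintype m] [DecidableEq m]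
    (Z : Matrix n n ℂ) (M : Matrix m m ℂ) (V : Matrix n m ℂ) (h : Z * V = V * M)
    (p : Polynomial ℝ) : Polynomial.aeval Z p * V = V * Polynomial.aeval M p := by
  induction p using Polynomial.induction_on' with
  | add p q hp hq => simp [Matrix.add_mul, Matrix.mul_add, hp, hq]
  | monomial k a =>
    have hk : Z ^ k * V = V * M ^ k := by
      induction k with
      | zero => simp
      | succ k ih => rw [pow_succ, Matrix.mul_assoc, h, ← Matrix.mul_assoc, ih, Matrix.mul_assoc,
          ← pow_succ]
    simp [Polynomial.aeval_monomial, ← Algebra.smul_def, hk]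

lemma aux_intertwine (f : ℝ → ℝ) {n m : Type*} [Fintype n] [DecidableEq n] [Fintype m]
    [DecidableEq m] (Z : Matrix n n ℂ) (M : Matrix m m ℂ) (hZ : Z.IsHermitian)
    (hM : M.IsHermitian) (V : Matrix n m ℂ) (h : Z * V = V * M) :
    cfc f Z * V = V * cfc f M := by
  obtain ⟨p, h1, h2⟩ := aux_poly f Z M hZ hM
  rw [h1, h2, aux_aeval_intertwine Z M V h]

lemma aux_diag (f : ℝ → ℝ) {n : Type*} [Fintype n] [DecidableEq n] (d : n → ℝ) :
    cfc f (diagonal (fun i => (d i : ℂ))) = diagonal (fun i => (f (d i) : ℂ)) := by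
  ext i j
  have hd : (diagonal (fun i => (d i : ℂ))).IsHermitian :=
    isHermitian_diagonal_of_self_adjoint _ (by ext; simp)
  let V : Matrix n Unit ℂ := Matrix.of fun a _ => if a = j then 1 else 0
  have hM : (diagonal (fun _ : Unit => (d j : ℂ))).IsHermitian :=
    isHermitian_diagonal_of_self_adjoint _ (by ext; simp)
  have h := aux_intertwine f _ _ hd hM V (by
    ext a b
    simp [V, diagonal_mul, mul_diagonal]
    split_ifs with h
    · rw [h]
    · rfl)
  have h3 : (diagonal (fun _ : Unit => (d j : ℂ))) = algebraMap ℝ (Matrix Unit Unit ℂ) (d j) := by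
    ext; simp [Matrix.algebraMap_matrix_apply]
  have h4 : cfc f (diagonal (fun _ : Unit => (d j : ℂ))) = algebraMap ℝ (Matrix Unit Unit ℂ) (f (d j)) := by
    rw [h3, cfc_algebraMap]
  rw [h4] at h
  have := congrFun (congrFun h i) ()
  simp [V, Matrix.mul_apply, Matrix.algebraMap_matrix_apply] at this
  rw [this, diagonal_apply]
  by_cases hij : i = j
  · subst hij; simp
  · simp [hij]

lemma aux_mono (f : ℝ → ℝ) (hf_mono : ∀ (m : ℕ) (X Y : Matrix (Fin m) (Fin m) ℂ), X.PosSemidef →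
      Y.PosSemidef → (Y - X).PosSemidef → (cfc f Y - cfc f X).PosSemidef)
    {n : Type*} [Fintype n] [DecidableEq n] (X Y : Matrix n n ℂ) (hX : X.PosSemidef)
    (hY : Y.PosSemidef) (h : (Y - X).PosSemidef) : (cfc f Y - cfc f X).PosSemidef := by
  let e := Fintype.equivFin n
  have key : ∀ Z : Matrix n n ℂ, Z.PosSemidef →
      cfc f (Z.submatrix e.symm e.symm) = (cfc f Z).submatrix e.symm e.symm := by
    intro Z hZ
    obtain ⟨p, h1, h2⟩ := aux_poly f Z (Z.submatrix e.symm e.symm) hZ.1 (hZ.submatrix _).1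
    rw [h1, h2]
    exact Polynomial.aeval_algHom_apply (Matrix.reindexAlgEquiv ℝ ℂ e).toAlgHom Z p
  have := hf_mono _ (X.submatrix e.symm e.symm) (Y.submatrix e.symm e.symm) (hX.submatrix _)
    (hY.submatrix _) (h.submatrix e.symm)
  rw [key X hX, key Y hY] at this
  have h2 := this.submatrix e
  simpa [Matrix.submatrix_sub] using h2

lemma aux_kron (f : ℝ → ℝ) (hf_super : ∀ x y : ℝ, 0 ≤ x → 0 ≤ y → f x * f y ≤ f (x * y))
    {n : Type*} [Fintype n] [DecidableEq n] (X Y : Matrix n n ℂ) (hX : X.PosSemidef)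
    (hY : Y.PosSemidef) : (cfc f (X ⊗ₖ Y) - cfc f X ⊗ₖ cfc f Y).PosSemidef := by
  let U : Matrix n n ℂ := hX.1.eigenvectorUnitary
  let V : Matrix n n ℂ := hY.1.eigenvectorUnitary
  let x := hX.1.eigenvalues
  let y := hY.1.eigenvalues
  have hU : U * Uᴴ = 1 := Unitary.mul_star_self_of_mem hX.1.eigenvectorUnitary.2
  have hV : V * Vᴴ = 1 := Unitary.mul_star_self_of_mem hY.1.eigenvectorUnitary.2
  have hU' : Uᴴ * U = 1 := Unitary.star_mul_self_of_mem hX.1.eigenvectorUnitary.2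
  have hV' : Vᴴ * V = 1 := Unitary.star_mul_self_of_mem hY.1.eigenvectorUnitary.2
  have hdg : ∀ {k : Type _} [Fintype k] [DecidableEq k] (d : k → ℝ),
      (diagonal (fun i => (d i : ℂ))).IsHermitian := fun d =>
    isHermitian_diagonal_of_self_adjoint _ (by ext; simp)
  have hXs : X = U * diagonal (fun i => (x i : ℂ)) * Uᴴ := hX.1.spectral_theorem
  have hYs : Y = V * diagonal (fun i => (y i : ℂ)) * Vᴴ := hY.1.spectral_theorem
  have hXU : X * U = U * diagonal (fun i => (x i : ℂ)) := by
    conv_lhs => rw [hXs]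
    rw [Matrix.mul_assoc, hU', Matrix.mul_one]
  have hYV : Y * V = V * diagonal (fun i => (y i : ℂ)) := by
    conv_lhs => rw [hYs]
    rw [Matrix.mul_assoc, hV', Matrix.mul_one]
  have e1 := aux_intertwine f _ _ hX.1 (hdg x) U hXU
  have e2 := aux_intertwine f _ _ hY.1 (hdg y) V hYV
  have hXY : (X ⊗ₖ Y).IsHermitian := by
    rw [Matrix.IsHermitian, conjTranspose_kronecker, hX.1.eq, hY.1.eq]
  have e3 := aux_intertwine f (X ⊗ₖ Y) (diagonal (fun i : n × n => ((x i.1 * y i.2 : ℝ) : ℂ)))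
    hXY (hdg fun i : n × n => x i.1 * y i.2) (U ⊗ₖ V) (by
      rw [← mul_kronecker_mul, hXU, hYV, mul_kronecker_mul, diagonal_kronecker_diagonal]
      simp)
  rw [aux_diag f] at e1 e2
  rw [aux_diag f (fun i : n × n => x i.1 * y i.2)] at e3
  have hW : (U ⊗ₖ V) * (U ⊗ₖ V)ᴴ = 1 := by
    rw [conjTranspose_kronecker, ← mul_kronecker_mul, hU, hV, one_kronecker_one]
  have e4 : (cfc f X ⊗ₖ cfc f Y) * (U ⊗ₖ V) =
      (U ⊗ₖ V) * diagonal (fun i : n × n => ((f (x i.1) * f (y i.2) : ℝ) : ℂ)) := by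
    rw [← mul_kronecker_mul, e1, e2, mul_kronecker_mul, diagonal_kronecker_diagonal]
    simp
  have e5 : cfc f (X ⊗ₖ Y) - cfc f X ⊗ₖ cfc f Y = (U ⊗ₖ V) *
      diagonal (fun i : n × n => ((f (x i.1 * y i.2) - f (x i.1) * f (y i.2) : ℝ) : ℂ))
        * (U ⊗ₖ V)ᴴ := by
    have : diagonal (fun i : n × n => ((f (x i.1 * y i.2) - f (x i.1) * f (y i.2) : ℝ) : ℂ)) =
      diagonal (fun i : n × n => ((f (x i.1 * y i.2) : ℝ) : ℂ)) -
      diagonal (fun i : n × n => ((f (x i.1) * f (y i.2) : ℝ) : ℂ)) := by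
      rw [diagonal_sub]; simp
    rw [this, Matrix.mul_sub, ← e3, ← e4, ← Matrix.sub_mul, Matrix.mul_assoc, hW, Matrix.mul_one]
  rw [e5]
  refine Matrix.PosSemidef.mul_mul_conjTranspose_same (PosSemidef.diagonal ?_) _
  intro i
  have := hf_super (x i.1) (y i.2) (hX.eigenvalues_nonneg _) (hY.eigenvalues_nonneg _)
  exact Complex.zero_le_real.mpr (sub_nonneg.mpr this)

lemma aux_limit (f : ℝ → ℝ) (hf_cont : ContinuousOn f (Set.Ici 0))
    {n : Type*} [Fintype n] [DecidableEq n] (L M : Matrix n n ℂ) (hM : M.PosSemidef)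
    (h : ∀ ε : ℝ, 0 < ε → (cfc f (((1 + ε : ℝ) : ℂ) • M) - L).PosSemidef) :
    (cfc f M - L).PosSemidef := by
  let U : Matrix n n ℂ := hM.1.eigenvectorUnitary
  let x := hM.1.eigenvalues
  have hx : ∀ i, 0 ≤ x i := hM.eigenvalues_nonneg
  have hU : U * Uᴴ = 1 := Unitary.mul_star_self_of_mem hM.1.eigenvectorUnitary.2
  have hU' : Uᴴ * U = 1 := Unitary.star_mul_self_of_mem hM.1.eigenvectorUnitary.2
  have hdg : ∀ (d : n → ℝ), (diagonal (fun i => (d i : ℂ))).IsHermitian := fun d =>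
    isHermitian_diagonal_of_self_adjoint _ (by ext; simp)
  have hMs : M = U * diagonal (fun i => (x i : ℂ)) * Uᴴ := hM.1.spectral_theorem
  have key : ∀ c : ℝ, cfc f ((c : ℂ) • M) = U * diagonal (fun i => (f (c * x i) : ℂ)) * Uᴴ := by
    intro c
    have hcM : ((c : ℂ) • M).IsHermitian := by
      rw [Matrix.IsHermitian, conjTranspose_smul, hM.1.eq]; simp
    have hd : diagonal (fun i => ((c * x i : ℝ) : ℂ)) = (c : ℂ) • diagonal (fun i => (x i : ℂ)) := by
      rw [← diagonal_smul]; congr 1; ext; simp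
    have e := aux_intertwine f _ _ hcM (hdg (fun i => c * x i)) U (by
      conv_lhs => rw [hMs]
      rw [hd, Matrix.smul_mul, Matrix.mul_assoc, hU', Matrix.mul_one, Matrix.mul_smul])
    rw [aux_diag f (fun i => c * x i)] at e
    rw [← e, Matrix.mul_assoc, hU, Matrix.mul_one]
  have h1 : cfc f M = U * diagonal (fun i => (f (1 * x i) : ℂ)) * Uᴴ := by
    rw [← key 1]; simp
  have hlim : Filter.Tendsto (fun ε : ℝ => U * diagonal (fun i => (f ((1 + ε) * x i) : ℂ)) * Uᴴ - L)
      (nhdsWithin 0 (Set.Ioi 0)) (nhds (U * diagonal (fun i => (f (1 * x i) : ℂ)) * Uᴴ - L)) := by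
    refine Filter.Tendsto.sub_const ?_ _
    have hc : Continuous (fun v : n → ℂ => U * diagonal v * Uᴴ) := by fun_prop
    refine (hc.tendsto _).comp ?_
    rw [tendsto_pi_nhds]
    intro i
    refine (Complex.continuous_ofReal.tendsto _).comp ?_
    have hfi : ContinuousWithinAt f (Set.Ici 0) (1 * x i) := hf_cont _ (by simpa using hx i)
    refine hfi.tendsto.comp ?_
    rw [tendsto_nhdsWithin_iff]
    constructor
    · have : Continuous (fun ε : ℝ => (1 + ε) * x i) := by fun_prop
      have := this.tendsto 0
      simp only [add_zero] at this
      exact this.mono_left nhdsWithin_le_nhds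
    · filter_upwards [self_mem_nhdsWithin] with ε hε
      have : 0 < ε := hε
      exact mul_nonneg (by linarith) (hx i)
  rw [h1]
  have hev : ∀ᶠ ε in nhdsWithin (0:ℝ) (Set.Ioi 0),
      (U * diagonal (fun i => (f ((1 + ε) * x i) : ℂ)) * Uᴴ - L).PosSemidef := by
    filter_upwards [self_mem_nhdsWithin] with ε hε
    rw [← key]; exact h ε hε
  have hcl : IsClosed {A : Matrix n n ℂ | A.PosSemidef} := by
    have : {A : Matrix n n ℂ | A.PosSemidef} =
      {A | Aᴴ = A} ∩ ⋂ v : n → ℂ, {A | 0 ≤ star v ⬝ᵥ (A *ᵥ v)} := by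
      ext A
      simp only [Set.mem_ofPred_eq, Set.mem_inter_iff, Set.mem_iInter]
      exact Matrix.posSemidef_iff_dotProduct_mulVec
    rw [this]
    refine (isClosed_eq (by fun_prop) continuous_id).inter (isClosed_iInter fun v => ?_)
    exact isClosed_le continuous_const (by fun_prop)
  exact hcl.mem_of_tendsto hlim hev

/-- The Hansen inequality for an isometry. -/
lemma aux_hansen (f : ℝ → ℝ) (hf_cont : ContinuousOn f (Set.Ici 0))
    (hf_mono : ∀ (m : ℕ) (X Y : Matrix (Fin m) (Fin m) ℂ), X.PosSemidef →
      Y.PosSemidef → (Y - X).PosSemidef → (cfc f Y - cfc f X).PosSemidef)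
    {n m : Type*} [Fintype n] [DecidableEq n] [Fintype m] [DecidableEq m]
    (W : Matrix n n ℂ) (V : Matrix n m ℂ) (hW : W.PosSemidef) (hV : Vᴴ * V = 1) :
    (cfc f (Vᴴ * W * V) - Vᴴ * cfc f W * V).PosSemidef := by
  have hM : (Vᴴ * W * V).PosSemidef := hW.conjTranspose_mul_mul_same V
  refine aux_limit f hf_cont _ _ hM fun ε hε => ?_
  let P : Matrix n n ℂ := V * Vᴴ
  let Q : Matrix n n ℂ := 1 - P
  have hP : Pᴴ = P := by simp [P]
  have hQ : Qᴴ = Q := by simp [Q, hP]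
  have hPV : P * V = V := by simp only [P]; rw [Matrix.mul_assoc, hV, Matrix.mul_one]
  have hQV : Q * V = 0 := by simp only [Q]; rw [Matrix.sub_mul, hPV, Matrix.one_mul, sub_self]
  have hPW : (P * W * P).PosSemidef := by
    have := hW.conjTranspose_mul_mul_same P
    rwa [hP] at this
  have hQW : (Q * W * Q).PosSemidef := by
    have := hW.conjTranspose_mul_mul_same Q
    rwa [hQ] at this
  let Z : Matrix n n ℂ := ((1 + ε : ℝ) : ℂ) • (P * W * P) + ((1 + ε⁻¹ : ℝ) : ℂ) • (Q * W * Q)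
  have hZ : Z.PosSemidef := by
    refine (hPW.smul ?_).add (hQW.smul ?_)
    · exact_mod_cast (by positivity : 0 ≤ 1 + ε)
    · exact_mod_cast (by positivity : 0 ≤ 1 + ε⁻¹)
  have hZV : Z * V = V * (((1 + ε : ℝ) : ℂ) • (Vᴴ * W * V)) := by
    simp only [Z]
    rw [Matrix.add_mul, Matrix.smul_mul, Matrix.smul_mul, Matrix.mul_assoc (P * W), hPV,
      Matrix.mul_assoc (Q * W), hQV]
    simp [P, Matrix.mul_assoc]
  have hZW : (Z - W).PosSemidef := by
    let K : Matrix n n ℂ := ((ε : ℝ) : ℂ) • P - Q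
    have hK : Kᴴ = K := by simp [K, hP, hQ]
    have h1 : (K * W * K).PosSemidef := by
      have := hW.conjTranspose_mul_mul_same K
      rwa [hK] at this
    have h2 : Z - W = ((ε⁻¹ : ℝ) : ℂ) • (K * W * K) := by
      have hWd : W = (P + Q) * W * (P + Q) := by simp [Q]
      have hε' : (ε : ℂ) ≠ 0 := by exact_mod_cast hε.ne'
      conv_lhs => rw [hWd]
      simp only [Z, K, Matrix.mul_add, Matrix.add_mul, Matrix.mul_sub, Matrix.sub_mul,
        Matrix.smul_mul, Matrix.mul_smul]
      push_cast
      match_scalars <;> field_simp <;> ring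
    rw [h2]
    exact h1.smul (by exact_mod_cast (by positivity : 0 ≤ ε⁻¹))
  have h3 := (aux_mono f hf_mono W Z hW hZ hZW).conjTranspose_mul_mul_same V
  have hM' : (((1 + ε : ℝ) : ℂ) • (Vᴴ * W * V)).PosSemidef :=
    hM.smul (by exact_mod_cast (by positivity : 0 ≤ 1 + ε))
  rw [Matrix.mul_sub, Matrix.sub_mul, Matrix.mul_assoc _ (cfc f Z),
    aux_intertwine f Z _ hZ.1 hM'.1 V hZV, ← Matrix.mul_assoc, hV, Matrix.one_mul] at h3
  exact h3

lemma aux_jensen (f : ℝ → ℝ) (hf_cont : ContinuousOn f (Set.Ici 0))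
    (hf_mono : ∀ (m : ℕ) (X Y : Matrix (Fin m) (Fin m) ℂ), X.PosSemidef →
      Y.PosSemidef → (Y - X).PosSemidef → (cfc f Y - cfc f X).PosSemidef)
    {n : Type*} [Fintype n] [DecidableEq n]
    (W₁ W₂ T₁ T₂ : Matrix n n ℂ) (h₁ : W₁.PosSemidef) (h₂ : W₂.PosSemidef)
    (hT : T₁ᴴ * T₁ + T₂ᴴ * T₂ = 1) :
    (cfc f (T₁ᴴ * W₁ * T₁ + T₂ᴴ * W₂ * T₂) - (T₁ᴴ * cfc f W₁ * T₁ + T₂ᴴ * cfc f W₂ * T₂)).PosSemidef := by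
  let W : Matrix (n ⊕ n) (n ⊕ n) ℂ := fromBlocks W₁ 0 0 W₂
  let J₁ : Matrix (n ⊕ n) n ℂ := fromRows 1 0
  let J₂ : Matrix (n ⊕ n) n ℂ := fromRows 0 1
  let V : Matrix (n ⊕ n) n ℂ := J₁ * T₁ + J₂ * T₂
  have e11 : J₁ᴴ * J₁ = 1 := by simp [J₁, conjTranspose_fromRows_eq_fromCols_conjTranspose, fromCols_mul_fromRows]
  have e12 : J₁ᴴ * J₂ = 0 := by simp [J₁, J₂, conjTranspose_fromRows_eq_fromCols_conjTranspose, fromCols_mul_fromRows]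
  have e21 : J₂ᴴ * J₁ = 0 := by simp [J₁, J₂, conjTranspose_fromRows_eq_fromCols_conjTranspose, fromCols_mul_fromRows]
  have e22 : J₂ᴴ * J₂ = 1 := by simp [J₂, conjTranspose_fromRows_eq_fromCols_conjTranspose, fromCols_mul_fromRows]
  have hWeq : W = J₁ * W₁ * J₁ᴴ + J₂ * W₂ * J₂ᴴ := by
    simp [W, J₁, J₂, conjTranspose_fromRows_eq_fromCols_conjTranspose, fromRows_mul, fromRows_mul_fromCols]
    ext (i | i) (j | j) <;> simp
  have hW : W.PosSemidef := by
    rw [hWeq]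
    exact (h₁.mul_mul_conjTranspose_same _).add (h₂.mul_mul_conjTranspose_same _)
  have w1 : W * J₁ = J₁ * W₁ := by
    rw [hWeq, Matrix.add_mul, Matrix.mul_assoc _ J₁ᴴ, Matrix.mul_assoc _ J₂ᴴ, e11, e21]; simp
  have w2 : W * J₂ = J₂ * W₂ := by
    rw [hWeq, Matrix.add_mul, Matrix.mul_assoc _ J₁ᴴ, Matrix.mul_assoc _ J₂ᴴ, e12, e22]; simp
  have g1 := aux_intertwine f W W₁ hW.1 h₁.1 J₁ w1
  have g2 := aux_intertwine f W W₂ hW.1 h₂.1 J₂ w2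
  have gen : ∀ (X₁ X₂ : Matrix n n ℂ) (X : Matrix (n ⊕ n) (n ⊕ n) ℂ), X * J₁ = J₁ * X₁ →
      X * J₂ = J₂ * X₂ → Vᴴ * X * V = T₁ᴴ * X₁ * T₁ + T₂ᴴ * X₂ * T₂ := by
    intro X₁ X₂ X hx1 hx2
    have a1 : X * V = J₁ * (X₁ * T₁) + J₂ * (X₂ * T₂) := by
      simp only [V]
      rw [Matrix.mul_add, ← Matrix.mul_assoc, ← Matrix.mul_assoc, hx1, hx2, Matrix.mul_assoc,
        Matrix.mul_assoc]
    have a2 : Vᴴ * J₁ = T₁ᴴ := by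
      simp only [V, conjTranspose_add, conjTranspose_mul]
      rw [Matrix.add_mul, Matrix.mul_assoc, Matrix.mul_assoc, e11, e21]; simp
    have a3 : Vᴴ * J₂ = T₂ᴴ := by
      simp only [V, conjTranspose_add, conjTranspose_mul]
      rw [Matrix.add_mul, Matrix.mul_assoc, Matrix.mul_assoc, e12, e22]; simp
    rw [Matrix.mul_assoc, a1, Matrix.mul_add, ← Matrix.mul_assoc, ← Matrix.mul_assoc Vᴴ J₂, a2, a3,
      Matrix.mul_assoc, Matrix.mul_assoc]
  have hV : Vᴴ * V = 1 := by
    have := gen 1 1 1 (by simp) (by simp)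
    simpa [hT] using this
  have := aux_hansen f hf_cont hf_mono W V hW hV
  rwa [gen _ _ _ w1 w2, gen _ _ _ g1 g2] at this

lemma aux_sqrt {n : Type*} [Fintype n] [DecidableEq n] (X : Matrix n n ℂ) (hX : X.PosDef) :
    (cfc Real.sqrt X)ᴴ = cfc Real.sqrt X ∧ cfc Real.sqrt X * cfc Real.sqrt X = X ∧
      IsUnit (cfc Real.sqrt X).det := by
  have hX' : IsSelfAdjoint X := hX.1
  have h2 : cfc Real.sqrt X * cfc Real.sqrt X = X := by
    rw [← cfc_mul Real.sqrt Real.sqrt X (by fun_prop) (by fun_prop)]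
    conv_rhs => rw [← cfc_id ℝ X hX']
    refine cfc_congr fun x hx => ?_
    rw [hX.1.spectrum_real_eq_range_eigenvalues] at hx
    obtain ⟨i, rfl⟩ := hx
    exact Real.mul_self_sqrt (hX.posSemidef.eigenvalues_nonneg i)
  refine ⟨cfc_predicate (R := ℝ) (p := IsSelfAdjoint) Real.sqrt X, h2, ?_⟩
  have : (cfc Real.sqrt X).det * (cfc Real.sqrt X).det ≠ 0 := by
    rw [← det_mul, h2]; exact hX.det_pos.ne'
  exact isUnit_iff_ne_zero.mpr (left_ne_zero_of_mul this)

lemma aux_superadd (f : ℝ → ℝ) (hf_cont : ContinuousOn f (Set.Ici 0))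
    (hf_mono : ∀ (m : ℕ) (X Y : Matrix (Fin m) (Fin m) ℂ), X.PosSemidef →
      Y.PosSemidef → (Y - X).PosSemidef → (cfc f Y - cfc f X).PosSemidef)
    {n : Type*} [Fintype n] [DecidableEq n]
    (W₁ W₂ R₁ R₂ S : Matrix n n ℂ) (h₁ : W₁.PosSemidef) (h₂ : W₂.PosSemidef)
    (hR₁ : R₁ᴴ = R₁) (hR₂ : R₂ᴴ = R₂) (hS : Sᴴ = S) (hSu : IsUnit S.det)
    (hSS : S * S = ((1 : ℂ) / 2) • (R₁ * R₁ + R₂ * R₂)) :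
    (S * cfc f (S⁻¹ * (((1 : ℂ) / 2) • (R₁ * W₁ * R₁ + R₂ * W₂ * R₂)) * S⁻¹) * S -
      ((1 : ℂ) / 2) • (R₁ * cfc f W₁ * R₁ + R₂ * cfc f W₂ * R₂)).PosSemidef := by
  let r : ℂ := ((Real.sqrt (1/2) : ℝ) : ℂ)
  have hr : star r = r := Complex.conj_ofReal _
  have hrr : r * r = 1 / 2 := by
    simp only [r]
    rw [← Complex.ofReal_mul, Real.mul_self_sqrt (by norm_num)]; norm_num
  have hSi : S⁻¹ᴴ = S⁻¹ := by rw [conjTranspose_nonsing_inv, hS]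
  have i1 : S * S⁻¹ = 1 := mul_nonsing_inv S hSu
  have i2 : S⁻¹ * S = 1 := nonsing_inv_mul S hSu
  have gen : ∀ R X : Matrix n n ℂ, Rᴴ = R → (r • (R * S⁻¹))ᴴ * X * (r • (R * S⁻¹)) =
      S⁻¹ * (((1 : ℂ) / 2) • (R * X * R)) * S⁻¹ := by
    intro R X hR
    rw [conjTranspose_smul, conjTranspose_mul, hSi, hR, hr, ← hrr]
    simp only [Matrix.smul_mul, Matrix.mul_smul, smul_smul, Matrix.mul_assoc]
  have gen2 : ∀ X Y : Matrix n n ℂ, S⁻¹ * (((1 : ℂ) / 2) • X) * S⁻¹ +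
      S⁻¹ * (((1 : ℂ) / 2) • Y) * S⁻¹ = S⁻¹ * (((1 : ℂ) / 2) • (X + Y)) * S⁻¹ := by
    intro X Y
    rw [smul_add, Matrix.mul_add, Matrix.add_mul]
  have hT : (r • (R₁ * S⁻¹))ᴴ * (r • (R₁ * S⁻¹)) + (r • (R₂ * S⁻¹))ᴴ * (r • (R₂ * S⁻¹)) = 1 := by
    have a := gen R₁ 1 hR₁
    have b := gen R₂ 1 hR₂
    rw [Matrix.mul_one, Matrix.mul_one] at a b
    rw [a, b, gen2, ← hSS, ← Matrix.mul_assoc, i2, Matrix.one_mul, i1]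
  have := aux_jensen f hf_cont hf_mono W₁ W₂ _ _ h₁ h₂ hT
  rw [gen _ _ hR₁, gen _ _ hR₁, gen _ _ hR₂, gen _ _ hR₂, gen2, gen2] at this
  have h3 := this.conjTranspose_mul_mul_same S
  rw [hS, Matrix.mul_sub, Matrix.sub_mul] at h3
  have h4 : ∀ X : Matrix n n ℂ, S * (S⁻¹ * X * S⁻¹) * S = X := by
    intro X
    rw [Matrix.mul_assoc, Matrix.mul_assoc _ S⁻¹, i2, Matrix.mul_one, ← Matrix.mul_assoc, i1,
      Matrix.one_mul]
  rwa [h4] at h3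

lemma aux_step {k : ℕ} (f : ℝ → ℝ)
    (hf_super : ∀ x y : ℝ, 0 ≤ x → 0 ≤ y → f x * f y ≤ f (x * y))
    (A B C D : Matrix (Fin k) (Fin k) ℂ)
    (hA : A.PosDef) (hB : B.PosDef) (hC : C.PosDef) (hD : D.PosDef) :
    ∃ R W : Matrix (Fin k × Fin k) (Fin k × Fin k) ℂ, W.PosSemidef ∧ Rᴴ = R ∧
      R * R = A ⊗ₖ B ∧ R * W * R = C ⊗ₖ D ∧
      (R * cfc f W * R - opConn f A C ⊗ₖ opConn f B D).PosSemidef := by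
  obtain ⟨a1, a2, a3⟩ := aux_sqrt A hA
  obtain ⟨b1, b2, b3⟩ := aux_sqrt B hB
  unfold opConn
  set S := cfc Real.sqrt A
  set T := cfc Real.sqrt B
  have hX : (S⁻¹ * C * S⁻¹).PosSemidef := by
    have := hC.posSemidef.conjTranspose_mul_mul_same S⁻¹
    rwa [conjTranspose_nonsing_inv, a1] at this
  have hY : (T⁻¹ * D * T⁻¹).PosSemidef := by
    have := hD.posSemidef.conjTranspose_mul_mul_same T⁻¹
    rwa [conjTranspose_nonsing_inv, b1] at this
  have h4 : ∀ S X : Matrix (Fin k) (Fin k) ℂ, IsUnit S.det → S * (S⁻¹ * X * S⁻¹) * S = X := by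
    intro S X hS
    rw [Matrix.mul_assoc, Matrix.mul_assoc _ S⁻¹, nonsing_inv_mul S hS, Matrix.mul_one,
      ← Matrix.mul_assoc, mul_nonsing_inv S hS, Matrix.one_mul]
  have hR : (S ⊗ₖ T)ᴴ = S ⊗ₖ T := by rw [conjTranspose_kronecker, a1, b1]
  refine ⟨S ⊗ₖ T, (S⁻¹ * C * S⁻¹) ⊗ₖ (T⁻¹ * D * T⁻¹), hX.kronecker hY, hR, ?_, ?_, ?_⟩
  · rw [← mul_kronecker_mul, a2, b2]
  · rw [← mul_kronecker_mul, ← mul_kronecker_mul, h4 _ _ a3, h4 _ _ b3]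
  · have := (aux_kron f hf_super _ _ hX hY).conjTranspose_mul_mul_same (S ⊗ₖ T)
    rw [hR, Matrix.mul_sub, Matrix.sub_mul] at this
    rwa [mul_kronecker_mul _ S _ T, mul_kronecker_mul S _ T]

/-- Lemma 4.3 (inequality (4.3)): for an operator monotone, super-multiplicative representing
function `f` and positive definite matrices `A, B, C, D`,
`(A σ_f C) ⊗ₛ (B σ_f D) ≤ (A ⊗ₛ B) σ_f (C ⊗ₛ D)`. -/
theorem opConn_symKron_le {k : ℕ} (f : ℝ → ℝ)
    (hf_cont : ContinuousOn f (Set.Ici 0))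
    (hf_nonneg : ∀ x : ℝ, 0 ≤ x → 0 ≤ f x)
    (hf_mono : ∀ (m : ℕ) (X Y : Matrix (Fin m) (Fin m) ℂ), X.PosSemidef → Y.PosSemidef →
      (Y - X).PosSemidef → (cfc f Y - cfc f X).PosSemidef)
    (hf_super : ∀ x y : ℝ, 0 ≤ x → 0 ≤ y → f x * f y ≤ f (x * y))
    (A B C D : Matrix (Fin k) (Fin k) ℂ)
    (hA : A.PosDef) (hB : B.PosDef) (hC : C.PosDef) (hD : D.PosDef) :
    (opConn f (symKron A B) (symKron C D)
      - symKron (opConn f A C) (opConn f B D)).PosSemidef := by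
  obtain ⟨R₁, W₁, w1, r1, s1, t1, p1⟩ := aux_step f hf_super A B C D hA hB hC hD
  obtain ⟨R₂, W₂, w2, r2, s2, t2, p2⟩ := aux_step f hf_super B A D C hB hA hD hC
  have hP : (symKron A B).PosDef := by
    unfold symKron
    exact ((hA.kronecker hB).add (hB.kronecker hA)).smul (by norm_num)
  obtain ⟨a1, a2, a3⟩ := aux_sqrt _ hP
  have h1 := aux_superadd f hf_cont hf_mono W₁ W₂ R₁ R₂ (cfc Real.sqrt (symKron A B)) w1 w2 r1 r2
    a1 a3 (by rw [a2, s1, s2, symKron])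
  rw [t1, t2] at h1
  have h2 := (p1.add p2).smul (by exact_mod_cast (by norm_num : (0 : ℝ) ≤ 1 / 2) : (0 : ℂ) ≤ ((1 / 2 : ℝ) : ℂ))
  have h3 := h1.add h2
  refine (congrArg Matrix.PosSemidef ?_).mp h3
  have e : ∀ X Y : Matrix (Fin k) (Fin k) ℂ,
      symKron X Y = ((1 : ℂ) / 2) • (X ⊗ₖ Y + Y ⊗ₖ X) := fun _ _ => rfl
  rw [e (opConn f A C), opConn.eq_1 f (symKron A B), e C D]
  push_cast
  module
end

section
/- Assume the field hypotheses (weights not needed). Then for any real number λ, (∫_Ω A_t^{λ+1} dμ(t)) ⊗_s (∫_Ω A_t^{λ−1} dμ(t)) ≤ ((a² + b²)/(2ab)) · (∫_Ω A_t^{λ} dμ(t))^{⊗2}, where real powers of the positive definite matrices A_t are defined by the functional calculus. -/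
open Matrix MeasureTheory
open scoped Kronecker ComplexOrder

attribute [local instance] Matrix.frobeniusNormedAddCommGroup Matrix.frobeniusNormedSpace

lemma kt_spec {k : ℕ} {a b : ℝ} {M : Matrix (Fin k) (Fin k) ℂ} (hM : M.IsHermitian)
    (h1 : (M - a • 1).PosSemidef)
    (h2 : ((b • 1 : Matrix (Fin k) (Fin k) ℂ) - M).PosSemidef) :
    ∀ x ∈ spectrum ℝ M, x ∈ Set.Icc a b := by
  open scoped MatrixOrder in
  intro x hx
  have e1 : algebraMap ℝ (Matrix (Fin k) (Fin k) ℂ) a ≤ M := by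
    rw [Matrix.le_iff, Algebra.algebraMap_eq_smul_one]; exact h1
  have e2 : M ≤ algebraMap ℝ (Matrix (Fin k) (Fin k) ℂ) b := by
    rw [Matrix.le_iff, Algebra.algebraMap_eq_smul_one]; exact h2
  exact ⟨(algebraMap_le_iff_le_spectrum (ha := hM)).1 e1 x hx,
    (le_algebraMap_iff_spectrum_le (ha := hM)).1 e2 x hx⟩

lemma kt_norm_bound {k : ℕ} (M : Matrix (Fin k) (Fin k) ℂ) (C : ℝ)
    (h : ∀ i j, ‖M i j‖ ≤ C) :
    ‖M‖ ≤ (∑ _i : Fin k, ∑ _j : Fin k, C ^ (2 : ℝ)) ^ (1 / 2 : ℝ) := by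
  rw [Matrix.frobenius_norm_def]
  gcongr with i _ j _
  exact h i j

lemma kt_cfc {k : ℕ} {M : Matrix (Fin k) (Fin k) ℂ} (hM : M.IsHermitian) (f : ℝ → ℝ) :
    cfc f M = (hM.eigenvectorUnitary : Matrix (Fin k) (Fin k) ℂ) *
      diagonal (fun i => ((f (hM.eigenvalues i) : ℝ) : ℂ)) *
      (hM.eigenvectorUnitary : Matrix (Fin k) (Fin k) ℂ)ᴴ := by
  rw [hM.cfc_eq, Matrix.IsHermitian.cfc, Unitary.conjStarAlgAut_apply]
  rfl

lemma kt_cfc_bound (k : ℕ) (C : ℝ) (hC : 0 ≤ C) : ∃ K : ℝ, ∀ (M : Matrix (Fin k) (Fin k) ℂ)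
    (_ : M.IsHermitian) (f : ℝ → ℝ) (_ : ∀ x ∈ spectrum ℝ M, |f x| ≤ C), ‖cfc f M‖ ≤ K := by
  refine ⟨(∑ _i : Fin k, ∑ _j : Fin k, (1:ℝ) ^ (2 : ℝ)) ^ (1 / 2 : ℝ) *
    (∑ _i : Fin k, ∑ _j : Fin k, C ^ (2 : ℝ)) ^ (1 / 2 : ℝ) *
    (∑ _i : Fin k, ∑ _j : Fin k, (1:ℝ) ^ (2 : ℝ)) ^ (1 / 2 : ℝ), fun M hM f hf => ?_⟩
  have hU := kt_norm_bound (hM.eigenvectorUnitary : Matrix (Fin k) (Fin k) ℂ) 1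
    (fun i j => entry_norm_bound_of_unitary hM.eigenvectorUnitary.2 i j)
  rw [kt_cfc hM]
  refine (Matrix.frobenius_norm_mul _ _).trans ?_
  rw [Matrix.frobenius_norm_conjTranspose]
  have hD := kt_norm_bound (diagonal (fun i => ((f (hM.eigenvalues i) : ℝ) : ℂ))) C
    (fun i j => by
      rw [Matrix.diagonal_apply]
      split_ifs
      · rw [Complex.norm_real]
        exact hf _ (hM.eigenvalues_mem_spectrum_real i)
      · simpa using hC)
  gcongr
  refine (Matrix.frobenius_norm_mul _ _).trans ?_
  gcongr

/-- Bochner integrability of a matrix field with respect to the Frobenius norm. -/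
def KInt {m : Type*} [Fintype m] {Ω : Type*} [MeasurableSpace Ω]
    (F : Ω → Matrix m m ℂ) (μ : Measure Ω) : Prop :=
  @Integrable (Matrix m m ℂ)
    (Matrix.frobeniusNormedAddCommGroup (m := m) (n := m)
      (α := ℂ)).toPseudoMetricSpace.toUniformSpace.toTopologicalSpace
    inferInstance Ω _ F μ

lemma kt_lin {E F : Type*} [NormedAddCommGroup E] [NormedSpace ℝ E] [FiniteDimensional ℝ E]
    [NormedAddCommGroup F] [NormedSpace ℝ F] [FiniteDimensional ℝ F]
    {Ω : Type*} [MeasurableSpace Ω] {μ : Measure Ω} (L : E →ₗ[ℝ] F) {f : Ω → E}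
    (hf : Integrable f μ) :
    Integrable (fun t => L (f t)) μ ∧ ∫ t, L (f t) ∂μ = L (∫ t, f t ∂μ) := by
  have := FiniteDimensional.complete ℝ E
  have := FiniteDimensional.complete ℝ F
  exact ⟨L.toContinuousLinearMap.integrable_comp hf,
    L.toContinuousLinearMap.integral_comp_comm hf⟩

lemma kt_lin3 {E F : Type*} [NormedAddCommGroup E] [NormedSpace ℝ E] [FiniteDimensional ℝ E]
    [NormedAddCommGroup F] [NormedSpace ℝ F] [FiniteDimensional ℝ F]
    {Ω : Type*} [MeasurableSpace Ω] {μ : Measure Ω} (L1 L2 L3 : E →ₗ[ℝ] F) {f g h : Ω → E}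
    (hf : Integrable f μ) (hg : Integrable g μ) (hh : Integrable h μ) :
    Integrable (fun t => L1 (f t) - (L2 (g t) + L3 (h t))) μ ∧
    ∫ t, (L1 (f t) - (L2 (g t) + L3 (h t))) ∂μ =
      L1 (∫ t, f t ∂μ) - (L2 (∫ t, g t ∂μ) + L3 (∫ t, h t ∂μ)) := by
  obtain ⟨i1, h1⟩ := kt_lin L1 hf
  obtain ⟨i2, h2⟩ := kt_lin L2 hg
  obtain ⟨i3, h3⟩ := kt_lin L3 hh
  refine ⟨i1.sub (i2.add i3), ?_⟩
  refine (integral_sub i1 (i2.add i3)).trans ?_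
  rw [h1]
  congr 1
  exact (integral_add i2 i3).trans (by rw [h2, h3])

lemma kt_integrable {k : ℕ} {Ω : Type*} [MeasurableSpace Ω]
    (μ : Measure Ω) [IsFiniteMeasure μ] (a b : ℝ)
    (A : Ω → Matrix (Fin k) (Fin k) ℂ) (hAmeas : AEStronglyMeasurable A μ)
    (hAherm : ∀ t, (A t).IsHermitian)
    (hs : ∀ t, ∀ x ∈ spectrum ℝ (A t), x ∈ Set.Icc a b)
    (f : ℝ → ℝ) (hf : ContinuousOn f (Set.Icc a b)) :
    KInt (fun t => cfc f (A t)) μ := by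
  obtain ⟨C, hC⟩ := isCompact_Icc.exists_bound_of_continuousOn hf
  obtain ⟨K, hK⟩ := kt_cfc_bound k (max C 0) (le_max_right _ _)
  refine Integrable.of_bound (C := K) ?_ (Filter.Eventually.of_forall fun t =>
    hK _ (hAherm t) f fun x hx => (hC x (hs t x hx)).trans (le_max_left _ _))
  have hp := fun n : ℕ => exists_polynomial_near_of_continuousOn a b f hf (1 / ((n : ℝ) + 1))
    Nat.one_div_pos_of_nat
  choose p hp using hp
  have aux : ∀ (E : Type) [NormedAddCommGroup E], TopologicalSpace.PseudoMetrizableSpace E :=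
    fun E _ => inferInstance
  have : TopologicalSpace.PseudoMetrizableSpace (Matrix (Fin k) (Fin k) ℂ) := aux _
  refine aestronglyMeasurable_of_tendsto_ae (u := Filter.atTop)
    (f := fun n t => cfc (p n).eval (A t)) ?_ (Filter.Eventually.of_forall fun t => ?_)
  · intro n
    have : (fun t => cfc (p n).eval (A t)) = fun t => Polynomial.aeval (A t) (p n) := by
      funext t
      exact cfc_polynomial (p n) (A t) (hAherm t)
    rw [this]
    exact (Polynomial.continuous_aeval (p n)).comp_aestronglyMeasurable hAmeas
  · refine tendsto_cfc_fun ?_ (Filter.Eventually.of_forall fun n => (p n).continuousOn)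
    rw [Metric.tendstoUniformlyOn_iff]
    intro ε hε
    obtain ⟨N, hN⟩ := exists_nat_one_div_lt hε
    filter_upwards [Filter.eventually_ge_atTop N] with n hn x hx
    rw [dist_comm, Real.dist_eq]
    refine (hp n x (hs t x hx)).trans (lt_of_le_of_lt ?_ hN)
    exact Nat.one_div_le_one_div hn

lemma kt_posSemidef_integral {n : Type*} [Fintype n] [DecidableEq n]
    {Ω : Type*} [MeasurableSpace Ω] (μ : Measure Ω)
    (F : Ω → Matrix n n ℂ) (hF : KInt F μ) (hp : ∀ t, (F t).PosSemidef) :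
    (∫ t, F t ∂μ).PosSemidef := by
  rw [Matrix.posSemidef_iff_dotProduct_mulVec]
  constructor
  · let L : Matrix n n ℂ →ₗ[ℝ] Matrix n n ℂ :=
      { toFun := fun M => Mᴴ, map_add' := by simp, map_smul' := by simp }
    have h := (kt_lin L hF).2
    have h2 : (fun t => L (F t)) = F := by
      funext t; exact (hp t).1
    rw [h2] at h
    exact h.symm
  · intro x
    let L : Matrix n n ℂ →ₗ[ℝ] ℂ :=
      { toFun := fun M => star x ⬝ᵥ (M *ᵥ x)
        map_add' := by simp [add_mulVec]
        map_smul' := by simp [smul_mulVec] }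
    have h := (kt_lin L hF).2
    change 0 ≤ L (∫ t, F t ∂μ)
    rw [← h]
    refine integral_nonneg fun t => ?_
    exact (Matrix.posSemidef_iff_dotProduct_mulVec.1 (hp t)).2 x

lemma kt_posSemidef_lin {m n : Type*} [Fintype n] [DecidableEq n] [Fintype m]
    {Ω : Type*} [MeasurableSpace Ω] (μ : Measure Ω)
    (F G H : Ω → Matrix m m ℂ) (hF : KInt F μ) (hG : KInt G μ) (hH : KInt H μ)
    (L1 L2 L3 : Matrix m m ℂ →ₗ[ℝ] Matrix n n ℂ)
    (hp : ∀ t, (L1 (F t) - (L2 (G t) + L3 (H t))).PosSemidef) :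
    (L1 (∫ t, F t ∂μ) - (L2 (∫ t, G t ∂μ) + L3 (∫ t, H t ∂μ))).PosSemidef := by
  obtain ⟨hi, he⟩ := kt_lin3 L1 L2 L3 hF hG hH
  rw [← he]
  exact kt_posSemidef_integral μ _ hi hp

lemma kt_scalar {a b x y l : ℝ} (ha : 0 < a) (hx : x ∈ Set.Icc a b) (hy : y ∈ Set.Icc a b) :
    0 ≤ (a ^ 2 + b ^ 2) / (a * b) * (x ^ l * y ^ l) -
      (x ^ (l + 1) * y ^ (l - 1) + x ^ (l - 1) * y ^ (l + 1)) := by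
  obtain ⟨hx1, hx2⟩ := hx
  obtain ⟨hy1, hy2⟩ := hy
  have x0 : 0 < x := ha.trans_le hx1
  have y0 : 0 < y := ha.trans_le hy1
  have b0 : 0 < b := x0.trans_le hx2
  rw [Real.rpow_add_one x0.ne', Real.rpow_add_one y0.ne', Real.rpow_sub_one x0.ne',
    Real.rpow_sub_one y0.ne']
  have key : (a ^ 2 + b ^ 2) / (a * b) - (x / y + y / x) =
      ((b * x - a * y) * (b * y - a * x)) / (a * b * x * y) := by
    field_simp
    ring
  have : (a ^ 2 + b ^ 2) / (a * b) * (x ^ l * y ^ l) -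
      (x ^ l * x * (y ^ l / y) + x ^ l / x * (y ^ l * y)) =
      (x ^ l * y ^ l) * ((a ^ 2 + b ^ 2) / (a * b) - (x / y + y / x)) := by
    field_simp
  rw [this, key]
  have e1 : 0 ≤ b * x - a * y := by nlinarith
  have e2 : 0 ≤ b * y - a * x := by nlinarith
  positivity

lemma kt_pointwise {k : ℕ} {a b : ℝ} (ha : 0 < a) (l : ℝ) {M N : Matrix (Fin k) (Fin k) ℂ}
    (hM : M.IsHermitian) (hN : N.IsHermitian)
    (sM : ∀ x ∈ spectrum ℝ M, x ∈ Set.Icc a b) (sN : ∀ x ∈ spectrum ℝ N, x ∈ Set.Icc a b) :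
    (((a ^ 2 + b ^ 2) / (a * b)) •
        (cfc (fun x : ℝ => x ^ l) M ⊗ₖ cfc (fun x : ℝ => x ^ l) N) -
      (cfc (fun x : ℝ => x ^ (l + 1)) M ⊗ₖ cfc (fun x : ℝ => x ^ (l - 1)) N +
        cfc (fun x : ℝ => x ^ (l - 1)) M ⊗ₖ cfc (fun x : ℝ => x ^ (l + 1)) N)).PosSemidef := by
  simp only [kt_cfc hM, kt_cfc hN, Matrix.mul_kronecker_mul, ← Matrix.conjTranspose_kronecker]
  set U := (hM.eigenvectorUnitary : Matrix (Fin k) (Fin k) ℂ) ⊗ₖ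
    (hN.eigenvectorUnitary : Matrix (Fin k) (Fin k) ℂ) with hU
  rw [← Matrix.smul_mul, ← Matrix.mul_smul, ← Matrix.add_mul, ← Matrix.mul_add, ← Matrix.sub_mul,
    ← Matrix.mul_sub]
  refine Matrix.PosSemidef.mul_mul_conjTranspose_same ?_ U
  rw [Matrix.diagonal_kronecker_diagonal, Matrix.diagonal_kronecker_diagonal,
    Matrix.diagonal_kronecker_diagonal, ← Matrix.diagonal_smul, Matrix.diagonal_add,
    Matrix.diagonal_sub, Matrix.posSemidef_diagonal_iff]
  intro i
  have := kt_scalar (l := l) ha (sM _ (hM.eigenvalues_mem_spectrum_real i.1))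
    (sN _ (hN.eigenvalues_mem_spectrum_real i.2))
  have h2 := Complex.zero_le_real.2 this
  convert h2 using 1
  simp

/-- Corollary 5.3 (Grüss type generalization): for any real `λ`,
`(∫ A_t^{λ+1} dμ) ⊗ₛ (∫ A_t^{λ-1} dμ) ≤ ((a²+b²)/(2ab)) (∫ A_t^{λ} dμ)^{⊗2}`. -/
theorem kantorovich_integral_tensor_rpow {k : ℕ} {Ω : Type*} [MeasurableSpace Ω]
    (μ : Measure Ω) [IsFiniteMeasure μ] (a b : ℝ) (ha : 0 < a) (hab : a ≤ b)
    (A : Ω → Matrix (Fin k) (Fin k) ℂ) (hAmeas : AEStronglyMeasurable A μ)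
    (hAherm : ∀ t, (A t).IsHermitian)
    (hAa : ∀ t, (A t - a • 1).PosSemidef)
    (hAb : ∀ t, ((b • 1 : Matrix (Fin k) (Fin k) ℂ) - A t).PosSemidef)
    (l : ℝ) :
    (((a ^ 2 + b ^ 2) / (2 * a * b)) •
        ((∫ t, cfc (fun x : ℝ => x ^ l) (A t) ∂μ) ⊗ₖ (∫ t, cfc (fun x : ℝ => x ^ l) (A t) ∂μ))
      - symKron (∫ t, cfc (fun x : ℝ => x ^ (l + 1)) (A t) ∂μ)
          (∫ t, cfc (fun x : ℝ => x ^ (l - 1)) (A t) ∂μ)).PosSemidef := by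
  have hs : ∀ t, ∀ x ∈ spectrum ℝ (A t), x ∈ Set.Icc a b := fun t =>
    kt_spec (hAherm t) (hAa t) (hAb t)
  have hi : ∀ r : ℝ, KInt (fun t => cfc (fun x : ℝ => x ^ r) (A t)) μ := fun r =>
    kt_integrable μ a b A hAmeas hAherm hs _ fun x hx =>
      (Real.continuousAt_rpow_const x r (Or.inl (ha.trans_le hx.1).ne')).continuousWithinAt
  let B := Matrix.kroneckerBilinear (l := Fin k) (m := Fin k) (n := Fin k) (p := Fin k)
    (α := ℂ) (R := ℝ)
  set c : ℝ := (a ^ 2 + b ^ 2) / (a * b) with hc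
  have step1 := fun s => kt_posSemidef_lin μ _ _ _ (hi l) (hi (l - 1)) (hi (l + 1))
    (c • B (cfc (fun x : ℝ => x ^ l) (A s)))
    (B (cfc (fun x : ℝ => x ^ (l + 1)) (A s))) (B (cfc (fun x : ℝ => x ^ (l - 1)) (A s)))
    (fun t => kt_pointwise ha l (hAherm s) (hAherm t) (hs s) (hs t))
  have step2 := kt_posSemidef_lin μ _ _ _ (hi l) (hi (l + 1)) (hi (l - 1))
    (c • B.flip (∫ t, cfc (fun x : ℝ => x ^ l) (A t) ∂μ))
    (B.flip (∫ t, cfc (fun x : ℝ => x ^ (l - 1)) (A t) ∂μ))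
    (B.flip (∫ t, cfc (fun x : ℝ => x ^ (l + 1)) (A t) ∂μ)) step1
  have step3 := step2.smul (a := (1 / 2 : ℂ)) (by norm_num [Complex.le_def])
  convert step3 using 1
  have : (a ^ 2 + b ^ 2) / (2 * a * b) = (1 / 2 : ℝ) * c := by
    rw [hc, mul_assoc, div_mul_div_comm, one_mul]
  rw [smul_sub, symKron, this, mul_smul]
  congr 1
  ext i j
  simp [B, kroneckerBilinear]
end
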